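/- Generalized Dyson Lemma: Let v be a potential with scattering length a_v supported in {|x| < R₀} as in the context. Let R > R₀ and let θ_R be the characteristic function of {|x| < R}. Let χ: ℝ³ → [0,1] be a radial function such that h := (1−χ)^ (the Fourier transform of 1−χ) is a bounded, integrable function on ℝ³. Define f_R(x) = sup_{|y| ≤ R} |h(x−y) − h(x)| and assume f_R is integrable; set w_R(x) = (2/π²) f_R(x) ∫_{ℝ³} f_R(y) dy. Let U: ℝ³ → [0,∞) be a measurable radial function supported in {R₀ ≤ |x| ≤ R} with ∫ U = 4π. Then for every ε > 0 and every Schwartz function ψ: ℝ³ → ℂ, ∫_{ℝ³} θ_R(x) |(χ(p)∇ψ)(x)|² dx + (1/2) ∫_{ℝ³} v(x)|ψ(x)|² dx ≥ (1−ε) a_v ∫_{ℝ³} U(x)|ψ(x)|² dx − (a_v/ε) ∫_{ℝ³} w_R(x)|ψ(x)|² dx, where χ(p)∇ψ denotes the ℂ³-valued function whose Fourier transform at p is χ(p)·(ip)·ψ̂(p). -/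

import Mathlib

/-!
STATEMENT 7: Generalized Dyson Lemma.
`v` is as in the scattering context (nonnegative, bounded, measurable, radial,
supported in `{|x| < R₀}`, scattering length `a`).  `R > R₀`, `θ_R` is the
characteristic function of `{|x| < R}`, `χ : ℝ³ → [0,1]` is radial with
`h := \widehat{1-χ}` bounded and integrable, `f_R(x) = sup_{|y|≤R} |h(x-y)-h(x)|`
is integrable, `w_R(x) = (2/π²) f_R(x) ∫ f_R`, and `U ≥ 0` is radial, supported
in `{R₀ ≤ |x| ≤ R}`, with `∫ U = 4π`.  Then for every `ε > 0` and every
Schwartz `ψ`,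
`∫ θ_R(x) |(χ(p)∇ψ)(x)|² dx + (1/2) ∫ v |ψ|²
   ≥ (1-ε) a ∫ U |ψ|² - (a/ε) ∫ w_R |ψ|²`,
where `χ(p)∇ψ` is the function whose Fourier transform at `p` is
`χ(p)·(ip)·ψ̂(p)` (realized below via the inverse Fourier transform).
We use the symmetric convention `ψ̂(p) = (2π)^{-3/2} ∫ e^{-i p·x} ψ(x) dx`.
-/

open MeasureTheory Real
open scoped RealInnerProductSpace

noncomputable section

abbrev R3 := EuclideanSpace ℝ (Fin 3)

/-- Fourier transform, convention `(2π)^{-3/2} ∫ e^{-i⟨x,p⟩} g(x) dx`. -/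
def ft (g : R3 → ℂ) (p : R3) : ℂ :=
  (((2 * π) ^ (-(3:ℝ)/2) : ℝ) : ℂ) * ∫ x : R3, Complex.exp (-(Complex.I * (⟪x, p⟫ : ℝ))) * g x

/-- Inverse Fourier transform, convention `(2π)^{-3/2} ∫ e^{+i⟨p,x⟩} g(p) dp`. -/
def ift (g : R3 → ℂ) (x : R3) : ℂ :=
  (((2 * π) ^ (-(3:ℝ)/2) : ℝ) : ℂ) * ∫ p : R3, Complex.exp (Complex.I * (⟪p, x⟫ : ℝ)) * g p

theorem measurePreserving_polar :
    MeasurePreserving (fun p : Metric.sphere (0 : R3) 1 × ℝ => p.2 • (p.1 : R3))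
      (((volume : Measure R3).toSphere.prod (volume.restrict (Set.Ioi (0 : ℝ)))).withDensity
        (fun p => ENNReal.ofReal (p.2 ^ 2))) volume := by
  have hval : MeasurePreserving (Subtype.val : Set.Ioi (0 : ℝ) → ℝ) (Measure.volumeIoiPow 2)
      ((volume.restrict (Set.Ioi (0 : ℝ))).withDensity (fun r => ENNReal.ofReal (r ^ 2))) := by
    refine ⟨measurable_subtype_coe, ?_⟩
    ext s hs
    rw [Measure.map_apply measurable_subtype_coe hs, Measure.volumeIoiPow,
      withDensity_apply _ (measurable_subtype_coe hs), withDensity_apply _ hs,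
      ← lintegral_indicator (measurable_subtype_coe hs), ← lintegral_indicator hs,
      ← lintegral_subtype_comap measurableSet_Ioi]
    rfl
  have h1 := ((volume : Measure R3).measurePreserving_homeomorphUnitSphereProd).symm
    (Homeomorph.toMeasurableEquiv (homeomorphUnitSphereProd R3))
  have hdim : Module.finrank ℝ R3 - 1 = 2 := by simp
  rw [hdim] at h1
  have h2 : MeasurePreserving (Subtype.val : ({0}ᶜ : Set R3) → R3)
      ((volume : Measure R3).comap (↑)) volume := by
    refine ⟨measurable_subtype_coe, ?_⟩
    rw [map_comap_subtype_coe (measurableSet_singleton _).compl, restrict_compl_singleton]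
  have h3 := h2.comp h1
  have h4 := (MeasurePreserving.id (volume : Measure R3).toSphere).prod hval
  rw [prod_withDensity_right (by fun_prop)] at h4
  refine ⟨by fun_prop, ?_⟩
  rw [← h4.map_eq, Measure.map_map (by fun_prop) h4.measurable]
  exact h3.map_eq

theorem integrable_polar {f : R3 → ℝ} (hf : Integrable f) :
    Integrable (fun p : Metric.sphere (0 : R3) 1 × ℝ => p.2 ^ 2 * f (p.2 • (p.1 : R3)))
      ((volume : Measure R3).toSphere.prod (volume.restrict (Set.Ioi (0 : ℝ)))) := by
  have h := measurePreserving_polar.integrable_comp hf.aestronglyMeasurable |>.2 hf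
  rw [integrable_withDensity_iff_integrable_smul' (by fun_prop) (by simp)] at h
  refine h.congr (Filter.Eventually.of_forall fun p => ?_)
  simp [ENNReal.toReal_ofReal (sq_nonneg p.2)]

theorem integral_polar {f : R3 → ℝ} (hf : AEStronglyMeasurable f volume) :
    ∫ x, f x = ∫ p : Metric.sphere (0 : R3) 1 × ℝ, p.2 ^ 2 * f (p.2 • (p.1 : R3))
      ∂((volume : Measure R3).toSphere.prod (volume.restrict (Set.Ioi (0 : ℝ)))) := by
  have h := measurePreserving_polar.map_eq
  have h1 := integral_map (f := f) measurePreserving_polar.measurable.aemeasurable (by rwa [h])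
  rw [h] at h1
  rw [h1, integral_withDensity_eq_integral_toReal_smul (by fun_prop) (by simp)]
  refine integral_congr_ae (Filter.Eventually.of_forall fun p => ?_)
  simp [ENNReal.toReal_ofReal (sq_nonneg p.2)]

theorem toSphere_real_univ :
    (volume : Measure R3).toSphere.real Set.univ = 4 * π := by
  rw [Measure.toSphere_real_apply_univ]
  simp [Measure.real, EuclideanSpace.volume_ball_fin_three]
  rw [ENNReal.toReal_ofReal (by positivity)]
  ring

theorem integral_primitive_smul_deriv {E : Type*} [NormedAddCommGroup E] [NormedSpace ℝ E]
    [CompleteSpace E] {q : ℝ → ℝ} {k k' : ℝ → E} {s : ℝ} (hs : 0 ≤ s)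
    (hq : IntervalIntegrable q volume 0 s) (hk' : Continuous k')
    (hk : ∀ r, HasDerivAt k (k' r) r) :
    ∫ r in (0:ℝ)..s, (∫ t in (0:ℝ)..r, q t) • k' r = ∫ t in (0:ℝ)..s, q t • (k s - k t) := by
  set F : ℝ → ℝ → E := fun r t => (Set.Iic r).indicator (fun t => q t • k' r) t with hF
  have hint : IntegrableOn F.uncurry (Set.uIoc 0 s ×ˢ Set.uIoc 0 s) := by
    have h1 : Integrable (fun z : ℝ × ℝ => q z.2 • k' z.1)
        ((volume.restrict (Set.uIoc 0 s)).prod (volume.restrict (Set.uIoc 0 s))) := by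
      have h2 : Integrable q (volume.restrict (Set.uIoc 0 s)) := intervalIntegrable_iff.1 hq
      have h3 : Integrable k' (volume.restrict (Set.uIoc 0 s)) :=
        intervalIntegrable_iff.1 (hk'.intervalIntegrable 0 s)
      exact (h2.smul_prod h3).swap
    rw [Measure.prod_restrict] at h1
    have h4 := h1.indicator
      (measurableSet_le measurable_snd measurable_fst : MeasurableSet {z : ℝ × ℝ | z.2 ≤ z.1})
    refine h4.congr (Filter.Eventually.of_forall fun z => ?_)
    simp [F, Function.uncurry, Set.indicator]
  have hsw := intervalIntegral_intervalIntegral_swap hint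
  have hl : ∀ r ∈ Set.uIcc 0 s, ∫ t in (0:ℝ)..s, F r t = (∫ t in (0:ℝ)..r, q t) • k' r := by
    intro r hr
    rw [Set.uIcc_of_le hs] at hr
    rw [← intervalIntegral.integral_smul_const, intervalIntegral.integral_of_le hs,
      intervalIntegral.integral_of_le hr.1]
    simp only [hF]
    rw [setIntegral_indicator measurableSet_Iic, Set.Ioc_inter_Iic, min_eq_right hr.2]
  have hr : ∀ t ∈ Set.uIcc 0 s, ∫ r in (0:ℝ)..s, F r t = q t • (k s - k t) := by
    intro t ht
    rw [Set.uIcc_of_le hs] at ht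
    rw [← intervalIntegral.integral_eq_sub_of_hasDerivAt (fun x _ => hk x)
      (hk'.intervalIntegrable _ _), ← intervalIntegral.integral_smul,
      intervalIntegral.integral_of_le hs, intervalIntegral.integral_of_le ht.2]
    have : ∀ r, F r t = (Set.Ici t).indicator (fun r => q t • k' r) r := by
      intro r; simp [hF, Set.indicator]
    simp only [this]
    rw [setIntegral_indicator measurableSet_Ici]
    refine setIntegral_congr_set ?_
    have h5 : (Set.Ioc 0 s ∩ Set.Ioi t : Set ℝ) = Set.Ioc t s := by
      ext x; simp only [Set.mem_inter_iff, Set.mem_Ioc, Set.mem_Ioi]; constructor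
      · rintro ⟨⟨_, h⟩, h'⟩; exact ⟨h', h⟩
      · rintro ⟨h', h⟩; exact ⟨⟨ht.1.trans_lt h', h⟩, h'⟩
    rw [← h5]
    exact (Filter.EventuallyEq.refl _ _).inter Ioi_ae_eq_Ici.symm
  rw [← intervalIntegral.integral_congr hl, ← intervalIntegral.integral_congr hr, hsw]

/-- The mean of `φ` over the sphere of radius `r`. -/
def sphereMean (φ : R3 → ℝ) (r : ℝ) : ℝ :=
  (4 * π)⁻¹ * ∫ ω : Metric.sphere (0 : R3) 1, φ (r • (ω : R3)) ∂(volume : Measure R3).toSphere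

/-- The mean over directions `ω` of the radial derivative of `φ` at `r • ω`. -/
def sphereMeanDeriv (φ : R3 → ℝ) (r : ℝ) : ℝ :=
  (4 * π)⁻¹ * ∫ ω : Metric.sphere (0 : R3) 1, fderiv ℝ φ (r • (ω : R3)) ω
    ∂(volume : Measure R3).toSphere

theorem continuous_fderiv_radial {φ : R3 → ℝ} (hφ : ContDiff ℝ 1 φ) :
    Continuous (fun p : ℝ × Metric.sphere (0 : R3) 1 => fderiv ℝ φ (p.1 • (p.2 : R3)) p.2) := by
  have h : Continuous (fderiv ℝ φ) := hφ.continuous_fderiv (by norm_num)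
  fun_prop

theorem continuous_sphereMeanDeriv {φ : R3 → ℝ} (hφ : ContDiff ℝ 1 φ) :
    Continuous (sphereMeanDeriv φ) := by
  have h := continuous_parametric_integral_of_continuous (μ := (volume : Measure R3).toSphere)
    (f := fun (r : ℝ) (ω : Metric.sphere (0 : R3) 1) => fderiv ℝ φ (r • (ω : R3)) ω)
    (continuous_fderiv_radial hφ) isCompact_univ
  simp only [Measure.restrict_univ] at h
  exact continuous_const.mul h

theorem hasDerivAt_sphereMean {φ : R3 → ℝ} (hφ : ContDiff ℝ 1 φ) (r : ℝ) :
    HasDerivAt (sphereMean φ) (sphereMeanDeriv φ r) r := by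
  have hc := continuous_fderiv_radial hφ
  have hφc := hφ.continuous
  obtain ⟨C, hC⟩ := ((isCompact_closedBall r 1).prod
    (isCompact_univ : IsCompact (Set.univ : Set (Metric.sphere (0 : R3) 1)))).exists_bound_of_continuousOn
    hc.continuousOn
  refine HasDerivAt.const_mul _ ?_
  refine (hasDerivAt_integral_of_dominated_loc_of_deriv_le
    (F := fun (r : ℝ) (ω : Metric.sphere (0 : R3) 1) => φ (r • (ω : R3)))
    (F' := fun (r : ℝ) (ω : Metric.sphere (0 : R3) 1) => fderiv ℝ φ (r • (ω : R3)) ω)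
    (bound := fun _ => C) (Metric.closedBall_mem_nhds r one_pos) ?_ ?_ ?_ ?_ ?_ ?_).2
  · exact Filter.Eventually.of_forall fun x => (by fun_prop : Continuous _).aestronglyMeasurable
  · exact (by fun_prop : Continuous _).integrable_of_hasCompactSupport
      (HasCompactSupport.of_compactSpace _)
  · exact (hc.comp (by fun_prop : Continuous fun ω => (r, ω))).aestronglyMeasurable
  · exact Filter.Eventually.of_forall fun ω x hx => hC (x, ω) ⟨hx, trivial⟩
  · exact integrable_const _
  · refine Filter.Eventually.of_forall fun ω x _ => ?_
    have h1 : HasFDerivAt φ (fderiv ℝ φ (x • (ω : R3))) (x • (ω : R3)) :=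
      (hφ.differentiable (by norm_num) _).hasFDerivAt
    have h2 : HasDerivAt (fun x : ℝ => x • (ω : R3)) (ω : R3) x := by
      simpa using (hasDerivAt_id x).smul_const (ω : R3)
    exact h1.comp_hasDerivAt x h2

theorem sphereMean_mem_Icc {φ : R3 → ℝ} (hφ : Continuous φ) {m M : ℝ}
    (h : ∀ x, m ≤ φ x ∧ φ x ≤ M) (r : ℝ) : m ≤ sphereMean φ r ∧ sphereMean φ r ≤ M := by
  have hi : Integrable (fun ω : Metric.sphere (0 : R3) 1 => φ (r • (ω : R3)))
      (volume : Measure R3).toSphere :=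
    (by fun_prop : Continuous _).integrable_of_hasCompactSupport
      (HasCompactSupport.of_compactSpace _)
  have h1 := integral_mono (integrable_const m) hi (fun ω => (h _).1)
  have h2 := integral_mono hi (integrable_const M) (fun ω => (h _).2)
  rw [integral_const, toSphere_real_univ, smul_eq_mul] at h1 h2
  unfold sphereMean
  constructor
  · rw [inv_mul_eq_div, le_div_iff₀ (by positivity)]; linarith
  · rw [inv_mul_eq_div, div_le_iff₀ (by positivity)]; linarith

theorem sphereMean_eq_of_forall {φ : R3 → ℝ} {r c : ℝ}
    (h : ∀ ω : Metric.sphere (0 : R3) 1, φ (r • (ω : R3)) = c) : sphereMean φ r = c := by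
  unfold sphereMean
  simp only [h]
  rw [integral_const, toSphere_real_univ, smul_eq_mul]
  field_simp

/-- The value of the radial function `v` at distance `|t|` from the origin. -/
def radialProfile (v : R3 → ℝ) (t : ℝ) : ℝ := v (EuclideanSpace.single 0 t)

theorem radialProfile_eq {v : R3 → ℝ} (hv : ∀ x y : R3, ‖x‖ = ‖y‖ → v x = v y)
    (t : ℝ) (ω : Metric.sphere (0 : R3) 1) :
    v (t • (ω : R3)) = radialProfile v t := by
  apply hv
  simp [norm_smul]

theorem measurable_radialProfile {v : R3 → ℝ} (hv : Measurable v) :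
    Measurable (radialProfile v) := by
  have h : Continuous fun t : ℝ => (EuclideanSpace.single 0 t : R3) :=
    continuous_iff_continuousAt.2 fun t => by
      have : (fun t : ℝ => (EuclideanSpace.single 0 t : R3))
          = fun t => t • (EuclideanSpace.single 0 1 : R3) := by
        ext t i; by_cases hi : i = 0 <;> simp [hi]
      rw [this]; fun_prop
  exact hv.comp h.measurable

theorem intervalIntegrable_of_measurable_of_bounded {f : ℝ → ℝ} (hf : Measurable f) {C : ℝ}
    (h0 : ∀ x, 0 ≤ f x) (hC : ∀ x, f x ≤ C) (a b : ℝ) : IntervalIntegrable f volume a b := by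
  refine (intervalIntegrable_const (c := C)).mono_fun hf.aestronglyMeasurable ?_
  refine Filter.Eventually.of_forall fun x => ?_
  change ‖f x‖ ≤ ‖C‖
  rw [Real.norm_of_nonneg (h0 x), Real.norm_of_nonneg ((h0 x).trans (hC x))]
  exact hC x

theorem hasFDerivAt_comp_norm {η : ℝ → ℝ} {b : ℝ} {x : R3} (hx : x ≠ 0)
    (h : HasDerivAt η b ‖x‖) :
    HasFDerivAt (fun y : R3 => η ‖y‖) ((b / ‖x‖) • innerSL ℝ x) x := by
  have h1 : HasFDerivAt (fun y : R3 => ‖y‖ ^ 2) (2 • innerSL ℝ x) x :=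
    (hasStrictFDerivAt_norm_sq x).hasFDerivAt
  have h2 := h1.sqrt (by positivity)
  have h3 : (fun y : R3 => √(‖y‖ ^ 2)) = fun y => ‖y‖ := by
    ext y; exact Real.sqrt_sq (norm_nonneg y)
  rw [h3] at h2
  have h4 := HasDerivAt.comp_hasFDerivAt x h h2
  have hx' : ‖x‖ ≠ 0 := norm_ne_zero_iff.2 hx
  refine h4.congr_fderiv ?_
  rw [Real.sqrt_sq (norm_nonneg x)]
  ext y
  simp
  field_simp

theorem exists_primitive_of_compactSupport_pos {β : ℝ → ℝ} (hβ : ContDiff ℝ (⊤ : ℕ∞) β)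
    (hc : HasCompactSupport β) (hpos : tsupport β ⊆ Set.Ioi 0) :
    ∃ (η : ℝ → ℝ) (δ M : ℝ), 0 < δ ∧ 0 < M ∧ ContDiff ℝ (⊤ : ℕ∞) η ∧
      (∀ r, HasDerivAt η (β r) r) ∧ (∀ r, |r| < δ → η r = η 0) ∧ (∀ r, M ≤ r → η r = 0) ∧
      (∀ r, M < r → β r = 0) ∧ (∀ r, r ≤ 0 → β r = 0) := by
  have h0 : (0 : ℝ) ∉ tsupport β := fun h => lt_irrefl (0 : ℝ) (hpos h)
  rw [notMem_tsupport_iff_eventuallyEq, Filter.EventuallyEq, Metric.eventually_nhds_iff] at h0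
  obtain ⟨δ, hδ, hδ'⟩ := h0
  obtain ⟨M, hM, hM'⟩ := (IsCompact.isBounded hc).subset_closedBall_lt 0 (0 : ℝ)
  have hz : ∀ r, M < r → β r = 0 := by
    intro r hr
    by_contra hne
    have := hM' (subset_tsupport β hne)
    rw [Metric.mem_closedBall, dist_zero_right, Real.norm_eq_abs] at this
    exact absurd (le_abs_self r) (by linarith)
  have hint : ∀ a b, IntervalIntegrable β volume a b := fun a b =>
    hβ.continuous.intervalIntegrable a b
  refine ⟨fun r => ∫ x in M..r, β x, δ, M, hδ, hM, ?_, ?_, ?_, ?_, hz, ?_⟩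
  · have hd : ∀ r, HasDerivAt (fun r => ∫ x in M..r, β x) (β r) r := fun r =>
      intervalIntegral.integral_hasDerivAt_right (hint _ _)
        (hβ.continuous.stronglyMeasurableAtFilter _ _) hβ.continuous.continuousAt
    rw [contDiff_infty_iff_deriv]
    refine ⟨fun r => (hd r).differentiableAt, ?_⟩
    rwa [funext fun r => (hd r).deriv]
  · exact fun r => intervalIntegral.integral_hasDerivAt_right (hint _ _)
        (hβ.continuous.stronglyMeasurableAtFilter _ _) hβ.continuous.continuousAt
  · intro r hr
    rw [← sub_eq_zero, intervalIntegral.integral_interval_sub_left (hint _ _) (hint _ _)]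
    refine intervalIntegral.integral_zero_ae (Filter.Eventually.of_forall fun x hx => hδ' ?_)
    rw [dist_zero_right, Real.norm_eq_abs]
    have := Set.abs_sub_left_of_mem_uIcc (Set.uIoc_subset_uIcc hx)
    simp at this
    exact this.trans_lt hr
  · intro r hr
    refine intervalIntegral.integral_zero_ae (Filter.Eventually.of_forall fun x hx => hz x ?_)
    rw [Set.uIoc_of_le hr] at hx
    exact hx.1
  · intro r hr
    by_contra hne
    exact absurd (hpos (subset_tsupport β hne)) (not_lt.2 hr)

/-- Half the potential times the averaged scattering solution, in radial measure. -/
def radialSource (v φ : R3 → ℝ) (t : ℝ) : ℝ :=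
  1 / 2 * (t ^ 2 * (radialProfile v t * sphereMean φ t))

theorem intervalIntegrable_radialSource {v φ : R3 → ℝ} (hv_meas : Measurable v)
    (hv_nonneg : ∀ x, 0 ≤ v x) (hv_bdd : ∃ C, ∀ x, v x ≤ C) (hφ : ContDiff ℝ 1 φ) (a b : ℝ) :
    IntervalIntegrable (radialSource v φ) volume a b := by
  obtain ⟨C, hC⟩ := hv_bdd
  have hu : Continuous (sphereMean φ) :=
    continuous_iff_continuousAt.2 fun r => (hasDerivAt_sphereMean hφ r).continuousAt
  have h1 := (intervalIntegrable_of_measurable_of_bounded (measurable_radialProfile hv_meas)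
    (fun t => hv_nonneg _) (fun t => hC _) a b).continuousOn_mul
    (by fun_prop : Continuous fun t : ℝ => 1 / 2 * (t ^ 2 * sphereMean φ t)).continuousOn
  refine h1.congr fun t _ => ?_
  simp only [radialSource]; ring

theorem integral_radial_test_eq_zero {v φ : R3 → ℝ}
    (hv_meas : Measurable v) (hv_nonneg : ∀ x, 0 ≤ v x) (hv_bdd : ∃ C, ∀ x, v x ≤ C)
    (hv_radial : ∀ x y : R3, ‖x‖ = ‖y‖ → v x = v y)
    (hφ : ContDiff ℝ 1 φ)
    (hφ_scatt : ∀ g : R3 → ℝ, ContDiff ℝ (⊤ : ℕ∞) g → HasCompactSupport g →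
      (∫ x : R3, ⟪gradient φ x, gradient g x⟫) + (1/2) * ∫ x : R3, v x * φ x * g x = 0)
    {β : ℝ → ℝ} (hβ : ContDiff ℝ (⊤ : ℕ∞) β) (hc : HasCompactSupport β)
    (hpos : tsupport β ⊆ Set.Ioi 0) :
    ∫ r, β r • (r ^ 2 * sphereMeanDeriv φ r - ∫ t in (0:ℝ)..r, radialSource v φ t) = 0 := by
  obtain ⟨η, δ, M, hδ, hM, hη, hη', hη0, hηM, hβM, hβ0⟩ :=
    exists_primitive_of_compactSupport_pos hβ hc hpos
  have hβc := hβ.continuous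
  have hηc := hη.continuous
  have hφc := hφ.continuous
  have hDc := continuous_sphereMeanDeriv hφ
  set g : R3 → ℝ := fun x => η ‖x‖ with hg
  have hg_smooth : ContDiff ℝ (⊤ : ℕ∞) g := by
    rw [contDiff_iff_contDiffAt]
    intro x
    by_cases hx : x = 0
    · have : g =ᶠ[nhds x] fun _ => η 0 := by
        rw [hx, Filter.EventuallyEq, Metric.eventually_nhds_iff]
        refine ⟨δ, hδ, fun y hy => hη0 _ ?_⟩
        rw [dist_zero_right] at hy
        rwa [abs_of_nonneg (norm_nonneg y)]
      exact contDiffAt_const.congr_of_eventuallyEq this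
    · exact hη.contDiffAt.comp x (contDiffAt_norm ℝ hx)
  have hg_supp : HasCompactSupport g :=
    HasCompactSupport.intro (isCompact_closedBall (0 : R3) M) fun x hx => hηM _ (by
      rw [Metric.mem_closedBall, dist_zero_right, not_le] at hx; exact hx.le)
  have hgc := hg_smooth.continuous
  have hw := hφ_scatt g hg_smooth hg_supp
  have hinner : ∀ x, ⟪gradient φ x, gradient g x⟫ = fderiv ℝ g x (gradient φ x) := by
    intro x
    rw [← toDual_gradient, InnerProductSpace.toDual_apply_apply, real_inner_comm]
  have hgrad : ∀ (ω : Metric.sphere (0 : R3) 1) (r : ℝ), 0 < r →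
      ⟪gradient φ (r • (ω : R3)), gradient g (r • (ω : R3))⟫
        = β r * fderiv ℝ φ (r • (ω : R3)) ω := by
    intro ω r hr
    have hn : ‖r • (ω : R3)‖ = r := by simp [norm_smul, abs_of_pos hr]
    have hne : r • (ω : R3) ≠ 0 := by rw [← norm_ne_zero_iff, hn]; exact hr.ne'
    rw [hinner, (hasFDerivAt_comp_norm hne (by rw [hn]; exact hη' r)).fderiv, hn,
      ← toDual_gradient, InnerProductSpace.toDual_apply_apply]
    simp only [smul_apply, innerSL_apply_apply, smul_eq_mul,
      real_inner_smul_left]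
    rw [real_inner_comm]
    field_simp
  have hcont1 : Continuous fun x => ⟪gradient φ x, gradient g x⟫ := by
    have h1 : Continuous (gradient φ) :=
      (InnerProductSpace.toDual ℝ R3).symm.continuous.comp (hφ.continuous_fderiv (by norm_num))
    have h2 : Continuous (gradient g) :=
      (InnerProductSpace.toDual ℝ R3).symm.continuous.comp (hg_smooth.continuous_fderiv (by simp))
    exact h1.inner h2
  have hint1 : Integrable fun x => ⟪gradient φ x, gradient g x⟫ := by
    refine hcont1.integrable_of_hasCompactSupport ?_
    refine (hg_supp.fderiv (𝕜 := ℝ)).mono fun x hx => ?_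
    contrapose! hx
    simp only [Function.mem_support, not_not] at hx ⊢
    rw [hinner, hx]; simp
  have hint2 : Integrable fun x => v x * φ x * g x := by
    obtain ⟨C, hC⟩ := hv_bdd
    have h1 : Integrable fun x => φ x * g x :=
      (hφc.mul hgc).integrable_of_hasCompactSupport hg_supp.mul_left
    refine (h1.bdd_mul (c := C) hv_meas.aestronglyMeasurable
      (Filter.Eventually.of_forall fun x => ?_)).congr
      (Filter.Eventually.of_forall fun x => ?_)
    · rw [Real.norm_of_nonneg (hv_nonneg x)]; exact hC x
    · simp only; ring
  have e1 : ∫ x, ⟪gradient φ x, gradient g x⟫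
      = 4 * π * ∫ r in (0:ℝ)..M, β r * (r ^ 2 * sphereMeanDeriv φ r) := by
    rw [integral_polar hint1.aestronglyMeasurable, integral_prod_symm _ (integrable_polar hint1),
      intervalIntegral.integral_of_le hM.le, ← integral_const_mul]
    rw [setIntegral_eq_of_subset_of_forall_sdiff_eq_zero measurableSet_Ioi
      (Set.Ioc_subset_Ioi_self : Set.Ioc 0 M ⊆ Set.Ioi 0)]
    · refine setIntegral_congr_fun measurableSet_Ioc fun r hr => ?_
      have hr' : 0 < r := hr.1
      simp only [hgrad _ r hr', integral_const_mul, sphereMeanDeriv]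
      field_simp
    · rintro r ⟨hr, hr2⟩
      have : M < r := by by_contra h; exact hr2 ⟨hr, not_lt.1 h⟩
      have hr' : 0 < r := hr
      simp [hgrad _ r hr', hβM r this]
  have e2 : (1/2) * ∫ x, v x * φ x * g x
      = 4 * π * ∫ r in (0:ℝ)..M, radialSource v φ r * η r := by
    rw [integral_polar hint2.aestronglyMeasurable, integral_prod_symm _ (integrable_polar hint2),
      intervalIntegral.integral_of_le hM.le, ← integral_const_mul, ← integral_const_mul]
    rw [setIntegral_eq_of_subset_of_forall_sdiff_eq_zero measurableSet_Ioi
      (Set.Ioc_subset_Ioi_self : Set.Ioc 0 M ⊆ Set.Ioi 0)]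
    · refine setIntegral_congr_fun measurableSet_Ioc fun r hr => ?_
      have hr' : 0 < r := hr.1
      have hn : ∀ ω : Metric.sphere (0 : R3) 1, ‖r • (ω : R3)‖ = r := fun ω => by
        simp [norm_smul, abs_of_pos hr']
      simp only [radialProfile_eq hv_radial, hg, hn, integral_const_mul, integral_mul_const,
        sphereMean, radialSource]
      field_simp
    · rintro r ⟨hr, hr2⟩
      have : M < r := by by_contra h; exact hr2 ⟨hr, not_lt.1 h⟩
      have hr' : 0 < r := hr
      have hn : ∀ ω : Metric.sphere (0 : R3) 1, ‖r • (ω : R3)‖ = r := fun ω => by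
        simp [norm_smul, abs_of_pos hr']
      simp only [hg, hn, hηM r this.le]; simp
  have hq := intervalIntegrable_radialSource hv_meas hv_nonneg hv_bdd hφ
  have e3 := integral_primitive_smul_deriv hM.le (hq 0 M) hβc hη'
  simp only [hηM M le_rfl, zero_sub, smul_eq_mul, mul_neg, intervalIntegral.integral_neg] at e3
  have hm : Continuous fun r => ∫ t in (0:ℝ)..r, radialSource v φ t :=
    intervalIntegral.continuous_primitive hq 0
  have e4 : ∫ r, β r • (r ^ 2 * sphereMeanDeriv φ r - ∫ t in (0:ℝ)..r, radialSource v φ t)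
      = ∫ r in (0:ℝ)..M, (β r * (r ^ 2 * sphereMeanDeriv φ r)
          - (∫ t in (0:ℝ)..r, radialSource v φ t) * β r) := by
    rw [intervalIntegral.integral_of_le hM.le]
    rw [← setIntegral_univ, setIntegral_eq_of_subset_of_forall_sdiff_eq_zero MeasurableSet.univ
      (Set.subset_univ (Set.Ioc 0 M))]
    · refine setIntegral_congr_fun measurableSet_Ioc fun r hr => ?_
      simp only [smul_eq_mul]; ring
    · rintro r ⟨_, hr2⟩
      have : β r = 0 := by
        by_cases h : r ≤ 0
        · exact hβ0 r h
        · exact hβM r (by by_contra h'; exact hr2 ⟨not_le.1 h, not_lt.1 h'⟩)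
      rw [this, zero_smul]
  rw [e4, intervalIntegral.integral_sub ((by fun_prop : Continuous _).intervalIntegrable _ _)
    ((by fun_prop : Continuous fun r => (∫ t in (0:ℝ)..r, radialSource v φ t) * β r).intervalIntegrable
      _ _), e3, sub_neg_eq_add]
  rw [e1, e2, ← mul_add] at hw
  exact (mul_eq_zero.1 hw).resolve_left (by positivity)

theorem continuous_sphereMean {φ : R3 → ℝ} (hφ : ContDiff ℝ 1 φ) : Continuous (sphereMean φ) :=
  continuous_iff_continuousAt.2 fun r => (hasDerivAt_sphereMean hφ r).continuousAt

theorem sq_mul_sphereMeanDeriv_eq {v φ : R3 → ℝ}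
    (hv_meas : Measurable v) (hv_nonneg : ∀ x, 0 ≤ v x) (hv_bdd : ∃ C, ∀ x, v x ≤ C)
    (hv_radial : ∀ x y : R3, ‖x‖ = ‖y‖ → v x = v y)
    (hφ : ContDiff ℝ 1 φ)
    (hφ_scatt : ∀ g : R3 → ℝ, ContDiff ℝ (⊤ : ℕ∞) g → HasCompactSupport g →
      (∫ x : R3, ⟪gradient φ x, gradient g x⟫) + (1/2) * ∫ x : R3, v x * φ x * g x = 0)
    {r : ℝ} (hr : 0 ≤ r) :
    r ^ 2 * sphereMeanDeriv φ r = ∫ t in (0:ℝ)..r, radialSource v φ t := by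
  have hq := intervalIntegrable_radialSource hv_meas hv_nonneg hv_bdd hφ
  have hm : Continuous fun r => ∫ t in (0:ℝ)..r, radialSource v φ t :=
    intervalIntegral.continuous_primitive hq 0
  have hDc := continuous_sphereMeanDeriv hφ
  have hF : Continuous fun r =>
      r ^ 2 * sphereMeanDeriv φ r - ∫ t in (0:ℝ)..r, radialSource v φ t := by fun_prop
  have hae := isOpen_Ioi.ae_eq_zero_of_integral_contDiff_smul_eq_zero (μ := volume)
    (U := Set.Ioi (0:ℝ)) (hF.locallyIntegrable.locallyIntegrableOn _)
    fun β hβ hc hs =>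
      integral_radial_test_eq_zero hv_meas hv_nonneg hv_bdd hv_radial hφ hφ_scatt hβ hc hs
  have heq := Measure.eqOn_open_of_ae_eq (μ := volume) (U := Set.Ioi (0:ℝ))
    (g := fun _ => (0:ℝ)) ((ae_restrict_iff' measurableSet_Ioi).2 hae) isOpen_Ioi
    hF.continuousOn continuousOn_const
  rcases hr.eq_or_lt with rfl | hr
  · simp
  · exact sub_eq_zero.1 (heq hr)

theorem sphereMean_eq_of_scattering {φ : R3 → ℝ} {R0 a : ℝ} (hR0 : 0 < R0)
    (hφ_eq : ∀ x : R3, R0 ≤ ‖x‖ → φ x = 1 - a / ‖x‖) {s : ℝ} (hs : R0 ≤ s) :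
    sphereMean φ s = 1 - a / s := by
  refine sphereMean_eq_of_forall fun ω => ?_
  have hn : ‖s • (ω : R3)‖ = s := by simp [norm_smul, abs_of_pos (hR0.trans_le hs)]
  rw [hφ_eq _ (by rw [hn]; exact hs), hn]

theorem sq_mul_sphereMeanDeriv_of_scattering {φ : R3 → ℝ} {R0 a : ℝ} (hR0 : 0 < R0)
    (hφ : ContDiff ℝ 1 φ) (hφ_eq : ∀ x : R3, R0 ≤ ‖x‖ → φ x = 1 - a / ‖x‖) {s : ℝ}
    (hs : R0 ≤ s) : s ^ 2 * sphereMeanDeriv φ s = a := by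
  have h1 : ∀ s ∈ Set.Ioi R0, s ^ 2 * sphereMeanDeriv φ s = a := by
    intro s hs
    have hs' : R0 < s := hs
    have hs0 : s ≠ 0 := (hR0.trans hs').ne'
    have hd : HasDerivAt (fun s : ℝ => 1 - a / s) (a / s ^ 2) s := by
      have := ((hasDerivAt_inv hs0).const_mul a).const_sub 1
      refine this.congr_deriv ?_
      field_simp
    have hev : sphereMean φ =ᶠ[nhds s] fun s : ℝ => 1 - a / s := by
      filter_upwards [isOpen_Ioi.mem_nhds hs] with t ht
      exact sphereMean_eq_of_scattering hR0 hφ_eq (le_of_lt ht)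
    rw [(hasDerivAt_sphereMean hφ s).unique (hd.congr_of_eventuallyEq hev)]
    field_simp
  have hDc := continuous_sphereMeanDeriv hφ
  have h2 : Set.EqOn (fun s => s ^ 2 * sphereMeanDeriv φ s) (fun _ => a)
      (closure (Set.Ioi R0)) :=
    Set.EqOn.closure h1 (by fun_prop) continuous_const
  rw [closure_Ioi] at h2
  exact h2 hs

/-- The radial energy of the scattering solution up to distance `s` is at most the scattering
length. -/
theorem integral_scattering_energy_le {u D q : ℝ → ℝ} {a s : ℝ} (hs : 0 ≤ s) (ha : 0 ≤ a)
    (hu : ∀ r, HasDerivAt u (D r) r) (hD : Continuous D) (hq : IntervalIntegrable q volume 0 s)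
    (hflux : ∀ r, 0 ≤ r → r ^ 2 * D r = ∫ t in (0:ℝ)..r, q t)
    (hqs : ∫ t in (0:ℝ)..s, q t = a) (hus : u s ≤ 1) :
    (∫ r in (0:ℝ)..s, ((r * D r) ^ 2 + q r * u r)) ≤ a := by
  have huc : Continuous u := continuous_iff_continuousAt.2 fun r => (hu r).continuousAt
  have h := integral_primitive_smul_deriv hs hq hD hu
  have h1 : ∫ r in (0:ℝ)..s, (∫ t in (0:ℝ)..r, q t) • D r = ∫ r in (0:ℝ)..s, (r * D r) ^ 2 := by
    refine intervalIntegral.integral_congr fun r hr => ?_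
    rw [Set.uIcc_of_le hs] at hr
    simp only [← hflux r hr.1, smul_eq_mul]; ring
  have hqu : IntervalIntegrable (fun t => q t * u t) volume 0 s := hq.mul_continuousOn huc.continuousOn
  have h2 : ∫ t in (0:ℝ)..s, q t • (u s - u t) = a * u s - ∫ t in (0:ℝ)..s, q t * u t := by
    simp only [smul_eq_mul, mul_sub]
    rw [intervalIntegral.integral_sub (hq.mul_const _) hqu, intervalIntegral.integral_mul_const, hqs]
  rw [intervalIntegral.integral_add ((by fun_prop : Continuous _).intervalIntegrable _ _) hqu,
    ← h1, h, h2]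
  nlinarith

theorem two_mul_norm_add_smul_le {d r k u l : ℝ} {τ p : ℂ} (hr : 0 ≤ r) (hk : 0 ≤ k)
    (hu : 0 ≤ u) (hl : 0 < l) :
    2 * ‖(r ^ 2 * d) • τ + (k * u) • p‖ ≤
      l * ((r * d) ^ 2 + k * u * u) + (r ^ 2 * ‖τ‖ ^ 2 + k * ‖p‖ ^ 2) / l := by
  have h1 : ‖(r ^ 2 * d) • τ + (k * u) • p‖ ≤ |r * d| * (r * ‖τ‖) + k * u * ‖p‖ := by
    refine (norm_add_le _ _).trans (le_of_eq ?_)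
    rw [norm_smul, norm_smul, Real.norm_eq_abs, Real.norm_eq_abs, abs_of_nonneg (mul_nonneg hk hu),
      abs_mul, abs_mul, abs_of_nonneg hr, abs_of_nonneg (sq_nonneg r)]
    ring
  have h2 : 2 * (|r * d| * (r * ‖τ‖)) ≤ l * (r * d) ^ 2 + r ^ 2 * ‖τ‖ ^ 2 / l := by
    rw [← sub_le_iff_le_add', le_div_iff₀ hl, ← sq_abs (r * d)]
    nlinarith [sq_nonneg (l * |r * d| - r * ‖τ‖)]
  have h3 : 2 * (u * ‖p‖) ≤ l * u ^ 2 + ‖p‖ ^ 2 / l := by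
    rw [← sub_le_iff_le_add', le_div_iff₀ hl]
    nlinarith [sq_nonneg (l * u - ‖p‖)]
  have h4 := mul_le_mul_of_nonneg_left h3 hk
  have h5 : (r ^ 2 * ‖τ‖ ^ 2 + k * ‖p‖ ^ 2) / l = r ^ 2 * ‖τ‖ ^ 2 / l + k * (‖p‖ ^ 2 / l) := by
    ring
  rw [h5]
  linarith

/-- Dyson's inequality on a ray: the radial energy of `ψ` up to distance `s` controls `|ψ(s)|²`,
where the derivative is only taken of an approximation `Φ` with oscillation error `B`. -/
theorem radial_energy_lower_bound {u D k : ℝ → ℝ} {ψ Φ τ : ℝ → ℂ} {a s B ε : ℝ}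
    (hs : 0 ≤ s) (ha : 0 ≤ a) (hε : 0 < ε) (hB0 : 0 ≤ B)
    (hk0 : ∀ r, 0 ≤ k r) (hk : IntervalIntegrable k volume 0 s)
    (hu0 : ∀ r, 0 ≤ u r) (hu : Continuous u) (hD : Continuous D)
    (hflux : ∀ r, 0 ≤ r → r ^ 2 * D r = ∫ t in (0:ℝ)..r, k t * u t)
    (hqs : ∫ t in (0:ℝ)..s, k t * u t = a)
    (henergy : (∫ r in (0:ℝ)..s, ((r * D r) ^ 2 + k r * u r * u r)) ≤ a)
    (hψ : Continuous ψ) (hτ : Continuous τ) (hΦ : ∀ r, HasDerivAt Φ (τ r) r)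
    (hB : ∀ t, 0 ≤ t → t ≤ s → ‖(ψ s - Φ s) - (ψ t - Φ t)‖ ≤ B) :
    (1 - ε) * a * ‖ψ s‖ ^ 2 - a / ε * B ^ 2 ≤
      ∫ r in (0:ℝ)..s, (r ^ 2 * ‖τ r‖ ^ 2 + k r * ‖ψ r‖ ^ 2) := by
  have hΦc : Continuous Φ := continuous_iff_continuousAt.2 fun r => (hΦ r).continuousAt
  have hq : IntervalIntegrable (fun t => k t * u t) volume 0 s :=
    hk.mul_continuousOn hu.continuousOn
  have hY : IntervalIntegrable (fun r => r ^ 2 * ‖τ r‖ ^ 2 + k r * ‖ψ r‖ ^ 2) volume 0 s :=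
    ((by fun_prop : Continuous fun r => r ^ 2 * ‖τ r‖ ^ 2).intervalIntegrable _ _).add
      (hk.mul_continuousOn (by fun_prop : Continuous fun r => ‖ψ r‖ ^ 2).continuousOn)
  have hX : IntervalIntegrable (fun r => (r * D r) ^ 2 + k r * u r * u r) volume 0 s :=
    ((by fun_prop : Continuous fun r => (r * D r) ^ 2).intervalIntegrable _ _).add
      (hq.mul_continuousOn hu.continuousOn)
  have hqv : ∀ {f : ℝ → ℂ}, Continuous f →
      IntervalIntegrable (fun t => (k t * u t) • f t) volume 0 s :=
    fun hf => hq.smul_continuousOn hf.continuousOn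
  have hF1 : IntervalIntegrable (fun r => (r ^ 2 * D r) • τ r) volume 0 s :=
    (by fun_prop : Continuous fun r => (r ^ 2 * D r) • τ r).intervalIntegrable _ _
  have hident : ∫ r in (0:ℝ)..s, ((r ^ 2 * D r) • τ r + (k r * u r) • ψ r)
      = a • ψ s - ∫ t in (0:ℝ)..s, (k t * u t) • ((ψ s - Φ s) - (ψ t - Φ t)) := by
    have h1 : ∫ r in (0:ℝ)..s, (r ^ 2 * D r) • τ r
        = ∫ t in (0:ℝ)..s, (k t * u t) • (Φ s - Φ t) := by
      rw [← integral_primitive_smul_deriv hs hq hτ hΦ]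
      refine intervalIntegral.integral_congr fun r hr => ?_
      rw [Set.uIcc_of_le hs] at hr
      simp only [hflux r hr.1]
    rw [intervalIntegral.integral_add hF1 (hqv hψ), h1,
      ← intervalIntegral.integral_add (hqv (by fun_prop)) (hqv hψ), ← hqs,
      ← intervalIntegral.integral_smul_const,
      ← intervalIntegral.integral_sub (hqv (by fun_prop)) (hqv (by fun_prop))]
    refine intervalIntegral.integral_congr fun r _ => ?_
    simp only [← smul_add, ← smul_sub]
    congr 1; ring
  have herr : ‖∫ t in (0:ℝ)..s, (k t * u t) • ((ψ s - Φ s) - (ψ t - Φ t))‖ ≤ a * B := by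
    rw [← hqs, ← intervalIntegral.integral_mul_const]
    refine intervalIntegral.norm_integral_le_of_norm_le hs
      (Filter.Eventually.of_forall fun t ht => ?_) (hq.mul_const _)
    rw [norm_smul, Real.norm_of_nonneg (mul_nonneg (hk0 t) (hu0 t))]
    exact mul_le_mul_of_nonneg_left (hB t ht.1.le ht.2) (mul_nonneg (hk0 t) (hu0 t))
  set F : ℝ → ℂ := fun r => (r ^ 2 * D r) • τ r + (k r * u r) • ψ r with hF
  have hFi : IntervalIntegrable F volume 0 s := hF1.add (hqv hψ)
  set e := ∫ r in (0:ℝ)..s, (r ^ 2 * ‖τ r‖ ^ 2 + k r * ‖ψ r‖ ^ 2) with he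
  have he0 : 0 ≤ e := intervalIntegral.integral_nonneg hs fun r _ =>
    add_nonneg (by positivity) (mul_nonneg (hk0 r) (by positivity))
  have hlow : a * (‖ψ s‖ - B) ≤ ‖∫ r in (0:ℝ)..s, F r‖ := by
    rw [hident]
    have := norm_sub_norm_le (a • ψ s)
      (∫ t in (0:ℝ)..s, (k t * u t) • ((ψ s - Φ s) - (ψ t - Φ t)))
    rw [norm_smul, Real.norm_of_nonneg ha] at this
    linarith
  have hup : ∀ l : ℝ, 0 < l → 2 * ‖∫ r in (0:ℝ)..s, F r‖ ≤ l * a + e / l := by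
    intro l hl
    have h1 : 2 * ‖∫ r in (0:ℝ)..s, F r‖ ≤ ∫ r in (0:ℝ)..s, 2 * ‖F r‖ := by
      rw [intervalIntegral.integral_const_mul]
      exact mul_le_mul_of_nonneg_left (intervalIntegral.norm_integral_le_integral_norm hs)
        (by norm_num)
    refine h1.trans ?_
    refine (intervalIntegral.integral_mono_on hs (hFi.norm.const_mul 2)
      ((hX.const_mul l).add (hY.div_const l)) fun r hr =>
        two_mul_norm_add_smul_le hr.1 (hk0 r) (hu0 r) hl).trans ?_
    rw [intervalIntegral.integral_add (hX.const_mul l) (hY.div_const l),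
      intervalIntegral.integral_const_mul, intervalIntegral.integral_div]
    gcongr
  have hεB : (1 - ε) * ‖ψ s‖ ^ 2 - B ^ 2 / ε ≤ (‖ψ s‖ - B) ^ 2 - B ^ 2 := by
    have : 2 * ‖ψ s‖ * B ≤ ε * ‖ψ s‖ ^ 2 + B ^ 2 / ε := by
      rw [← sub_le_iff_le_add', le_div_iff₀ hε]
      nlinarith [sq_nonneg (ε * ‖ψ s‖ - B)]
    linarith
  have hgoal : (1 - ε) * a * ‖ψ s‖ ^ 2 - a / ε * B ^ 2
      = a * ((1 - ε) * ‖ψ s‖ ^ 2 - B ^ 2 / ε) := by ring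
  rw [hgoal]
  refine (mul_le_mul_of_nonneg_left hεB ha).trans ?_
  rcases le_or_gt ‖ψ s‖ B with hle | hlt
  · have : (‖ψ s‖ - B) ^ 2 - B ^ 2 ≤ 0 := by nlinarith [norm_nonneg (ψ s)]
    exact (mul_nonpos_of_nonneg_of_nonpos ha this).trans he0
  · have hl : 0 < ‖ψ s‖ - B := sub_pos.2 hlt
    have h1 := hup _ hl
    have h2 : a * (‖ψ s‖ - B) ≤ e / (‖ψ s‖ - B) := by linarith
    rw [le_div_iff₀ hl] at h2
    nlinarith [mul_nonneg ha (sq_nonneg B)]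

theorem ft_const_sq : ((2 * π) ^ (-(3:ℝ)/2)) ^ 2 = 1 / (8 * π ^ 3) := by
  rw [← Real.rpow_natCast, ← Real.rpow_mul (by positivity)]
  norm_num
  field_simp
  norm_num

theorem ft_schwartz (ψ : SchwartzMap R3 ℂ) (p : R3) :
    ft (fun y => ψ y) p = (((2 * π) ^ (-(3:ℝ)/2) : ℝ) : ℂ) *
      (FourierTransform.fourier ψ : SchwartzMap R3 ℂ) ((2 * π)⁻¹ • p) := by
  unfold ft
  rw [SchwartzMap.fourier_coe, Real.fourier_eq']
  congr 1
  refine integral_congr_ae (Filter.Eventually.of_forall fun x => ?_)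
  simp only [smul_eq_mul, real_inner_smul_right]
  congr 2
  push_cast
  field_simp

theorem integrable_ft_schwartz (ψ : SchwartzMap R3 ℂ) : Integrable (ft fun y => ψ y) := by
  rw [funext (ft_schwartz ψ)]
  exact ((FourierTransform.fourier ψ : SchwartzMap R3 ℂ).integrable.comp_smul
    (by positivity)).const_mul _

theorem integrable_norm_mul_ft_schwartz (ψ : SchwartzMap R3 ℂ) :
    Integrable (fun p => ‖p‖ * ‖ft (fun y => ψ y) p‖) := by
  have h := ((FourierTransform.fourier ψ : SchwartzMap R3 ℂ).integrable_pow_mul volume 1).comp_smul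
    (R := (2 * π)⁻¹) (by positivity)
  refine (h.const_mul (2 * π * ((2 * π) ^ (-(3:ℝ)/2)))).congr
    (Filter.Eventually.of_forall fun p => ?_)
  simp only [ft_schwartz, norm_mul, norm_smul, Complex.norm_real, pow_one]
  rw [Real.norm_of_nonneg (by positivity), Real.norm_of_nonneg (by positivity)]
  field_simp

theorem ift_ft_schwartz (ψ : SchwartzMap R3 ℂ) (x : R3) : ift (ft fun y => ψ y) x = ψ x := by
  have h : FourierTransformInv.fourierInv (FourierTransform.fourier ψ) x = ψ x := by simp
  rw [SchwartzMap.fourierInv_coe, Real.fourierInv_eq'] at h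
  unfold ift
  rw [← h]
  have h2 := Measure.integral_comp_inv_smul (volume : Measure R3)
    (fun v => Complex.exp (((2 * π * ⟪v, x⟫ : ℝ) : ℂ) * Complex.I) •
      (FourierTransform.fourier ψ : SchwartzMap R3 ℂ) v) (2 * π)
  have h3 : ∫ p : R3, Complex.exp (Complex.I * (⟪p, x⟫ : ℝ)) * ft (fun y => ψ y) p
      = (((2 * π) ^ (-(3:ℝ)/2) : ℝ) : ℂ) * ∫ p : R3,
        Complex.exp (((2 * π * ⟪(2 * π)⁻¹ • p, x⟫ : ℝ) : ℂ) * Complex.I) •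
      (FourierTransform.fourier ψ : SchwartzMap R3 ℂ) ((2 * π)⁻¹ • p) := by
    rw [← integral_const_mul]
    refine integral_congr_ae (Filter.Eventually.of_forall fun p => ?_)
    simp only [smul_eq_mul, ft_schwartz, real_inner_smul_left]
    have : (2 * π * ((2 * π)⁻¹ * ⟪p, x⟫)) = ⟪p, x⟫ := by field_simp
    rw [this, mul_comm Complex.I]; ring
  rw [h3, h2, ← mul_assoc, ← Complex.ofReal_mul, ← sq, ft_const_sq, finrank_euclideanSpace_fin,
    abs_of_pos (by positivity), Complex.real_smul, ← mul_assoc, ← Complex.ofReal_mul]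
  have : 1 / (8 * π ^ 3) * (2 * π) ^ 3 = 1 := by field_simp; norm_num
  rw [this]; simp

theorem norm_exp_I_mul_inner (p x : R3) : ‖Complex.exp (Complex.I * (⟪p, x⟫ : ℝ))‖ = 1 :=
  Complex.norm_exp_I_mul_ofReal _

theorem integrable_exp_mul {G : R3 → ℂ} (hG : Integrable G) (x : R3) :
    Integrable (fun p : R3 => Complex.exp (Complex.I * (⟪p, x⟫ : ℝ)) * G p) :=
  hG.bdd_mul (c := 1) (by fun_prop : Continuous _).aestronglyMeasurable
    (Filter.Eventually.of_forall fun p => (norm_exp_I_mul_inner p x).le)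

theorem ift_sub {G H : R3 → ℂ} (hG : Integrable G) (hH : Integrable H) (x : R3) :
    ift G x - ift H x = ift (fun p => G p - H p) x := by
  simp only [ift, mul_sub]
  rw [integral_sub (integrable_exp_mul hG x) (integrable_exp_mul hH x), mul_sub]

theorem continuous_ift {G : R3 → ℂ} (hG : Integrable G) : Continuous (ift G) := by
  refine continuous_const.mul (continuous_of_dominated (bound := fun p => ‖G p‖)
    (fun x => (integrable_exp_mul hG x).aestronglyMeasurable)
    (fun x => Filter.Eventually.of_forall fun p => ?_) hG.norm
    (Filter.Eventually.of_forall fun p => by fun_prop))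
  rw [norm_mul, norm_exp_I_mul_inner, one_mul]

theorem integrable_coord_mul {G : R3 → ℂ} (hG : Integrable G)
    (hG1 : Integrable (fun p : R3 => ‖p‖ * ‖G p‖)) (j : Fin 3) :
    Integrable (fun p : R3 => Complex.I * (p j : ℂ) * G p) := by
  refine hG1.mono' ((by fun_prop : Continuous fun p : R3 =>
    Complex.I * (p j : ℂ)).aestronglyMeasurable.mul hG.aestronglyMeasurable)
    (Filter.Eventually.of_forall fun p => ?_)
  simp only [norm_mul, Complex.norm_I, one_mul, Complex.norm_real]
  exact mul_le_mul_of_nonneg_right (PiLp.norm_apply_le p j) (norm_nonneg _)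

theorem hasDerivAt_ift_radial {G : R3 → ℂ} (hG : Integrable G)
    (hG1 : Integrable (fun p : R3 => ‖p‖ * ‖G p‖)) {ω : R3} (hω : ‖ω‖ = 1) (r : ℝ) :
    HasDerivAt (fun r : ℝ => ift G (r • ω))
      (∑ j : Fin 3, (ω j : ℂ) * ift (fun p => Complex.I * (p j : ℂ) * G p) (r • ω)) r := by
  have hsum : ∑ j : Fin 3, (ω j : ℂ) * ift (fun p => Complex.I * (p j : ℂ) * G p) (r • ω)
      = (((2 * π) ^ (-(3:ℝ)/2) : ℝ) : ℂ) * ∫ p : R3,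
        (Complex.exp (Complex.I * (⟪p, r • ω⟫ : ℝ)) * (Complex.I * (⟪p, ω⟫ : ℝ))) * G p := by
    have h1 : ∀ j : Fin 3, (ω j : ℂ) * ift (fun p => Complex.I * (p j : ℂ) * G p) (r • ω)
        = (((2 * π) ^ (-(3:ℝ)/2) : ℝ) : ℂ) * ∫ p : R3, (ω j : ℂ) *
          (Complex.exp (Complex.I * (⟪p, r • ω⟫ : ℝ)) * (Complex.I * (p j : ℂ) * G p)) := by
      intro j
      rw [integral_const_mul, ift]; ring
    simp only [h1]
    rw [← Finset.mul_sum, ← integral_finsetSum _ fun j _ =>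
      (integrable_exp_mul (integrable_coord_mul hG hG1 j) _).const_mul _]
    congr 1
    refine integral_congr_ae (Filter.Eventually.of_forall fun p => ?_)
    have h2 : ((⟪p, ω⟫ : ℝ) : ℂ) = ∑ j : Fin 3, (ω j : ℂ) * (p j : ℂ) := by
      rw [PiLp.inner_apply]; push_cast; simp
    simp only [h2, Finset.mul_sum, Finset.sum_mul]
    exact Finset.sum_congr rfl fun j _ => by ring
  rw [hsum]
  refine HasDerivAt.const_mul _ ?_
  refine (hasDerivAt_integral_of_dominated_loc_of_deriv_le
    (F := fun (r : ℝ) (p : R3) => Complex.exp (Complex.I * (⟪p, r • ω⟫ : ℝ)) * G p)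
    (F' := fun (r : ℝ) (p : R3) =>
      (Complex.exp (Complex.I * (⟪p, r • ω⟫ : ℝ)) * (Complex.I * (⟪p, ω⟫ : ℝ))) * G p)
    (bound := fun p => ‖p‖ * ‖G p‖) Filter.univ_mem ?_ ?_ ?_ ?_ hG1 ?_).2
  · exact Filter.Eventually.of_forall fun r => (integrable_exp_mul hG _).aestronglyMeasurable
  · exact integrable_exp_mul hG _
  · exact (by fun_prop : Continuous fun p : R3 => Complex.exp (Complex.I * (⟪p, r • ω⟫ : ℝ)) *
      (Complex.I * (⟪p, ω⟫ : ℝ))).aestronglyMeasurable.mul hG.aestronglyMeasurable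
  · refine Filter.Eventually.of_forall fun p r _ => ?_
    rw [norm_mul, norm_mul, norm_exp_I_mul_inner, norm_mul, Complex.norm_I, one_mul, one_mul,
      Complex.norm_real]
    refine mul_le_mul_of_nonneg_right ?_ (norm_nonneg _)
    simpa [hω] using norm_inner_le_norm (𝕜 := ℝ) p ω
  · refine Filter.Eventually.of_forall fun p r _ => ?_
    refine HasDerivAt.mul_const ?_ _
    refine HasDerivAt.cexp ?_
    refine HasDerivAt.const_mul _ ?_
    simp only [real_inner_smul_right]
    refine HasDerivAt.ofReal_comp ?_
    simpa using (hasDerivAt_id r).mul_const (⟪p, ω⟫ : ℝ)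

theorem ft_eq_ift_neg (g : R3 → ℂ) (p : R3) : ft g p = ift g (-p) := by
  simp only [ft, ift, inner_neg_right, Complex.ofReal_neg, mul_neg]

theorem ift_mul_ft_eq_convolution {m : R3 → ℂ} (hm : Integrable m) (ψ : SchwartzMap R3 ℂ)
    (x : R3) :
    ift (fun p => m p * ft (fun y => ψ y) p) x
      = (((2 * π) ^ (-(3:ℝ)/2) : ℝ) : ℂ) * ∫ y : R3, ψ y * ft m (y - x) := by
  unfold ift
  congr 1
  set K : ℂ := (((2 * π) ^ (-(3:ℝ)/2) : ℝ) : ℂ) with hK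
  have hint : Integrable (fun z : R3 × R3 =>
      Complex.exp (Complex.I * ((⟪z.1, x - z.2⟫ : ℝ) : ℂ)) * (m z.1 * ψ z.2))
      ((volume : Measure R3).prod volume) :=
    (hm.mul_prod ψ.integrable).bdd_mul (c := 1) (by fun_prop : Continuous _).aestronglyMeasurable
      (Filter.Eventually.of_forall fun z => (norm_exp_I_mul_inner z.1 (x - z.2)).le)
  calc ∫ p : R3, Complex.exp (Complex.I * (⟪p, x⟫ : ℝ)) * (m p * ft (fun y => ψ y) p)
      = K * ∫ p : R3, ∫ y : R3,
          Complex.exp (Complex.I * ((⟪p, x - y⟫ : ℝ) : ℂ)) * (m p * ψ y) := by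
        rw [← integral_const_mul]
        refine integral_congr_ae (Filter.Eventually.of_forall fun p => ?_)
        simp only [ft, ← hK]
        have h1 : ∀ y : R3, Complex.exp (Complex.I * ((⟪p, x - y⟫ : ℝ) : ℂ)) * (m p * ψ y)
            = (Complex.exp (Complex.I * (⟪p, x⟫ : ℝ)) * m p) *
              (Complex.exp (-(Complex.I * (⟪y, p⟫ : ℝ))) * ψ y) := by
          intro y
          rw [inner_sub_right, real_inner_comm p y, Complex.ofReal_sub, mul_sub, sub_eq_add_neg,
            Complex.exp_add]
          ring
        simp only [h1, integral_const_mul]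
        ring
    _ = K * ∫ y : R3, ∫ p : R3,
          Complex.exp (Complex.I * ((⟪p, x - y⟫ : ℝ) : ℂ)) * (m p * ψ y) := by
        rw [integral_integral_swap hint]
    _ = ∫ y : R3, ψ y * ft m (y - x) := by
        rw [← integral_const_mul]
        refine integral_congr_ae (Filter.Eventually.of_forall fun y => ?_)
        simp only [ft_eq_ift_neg, neg_sub, ift, ← hK]
        simp only [← mul_assoc, integral_mul_const]
        ring

theorem sq_integral_mul_le {f g : R3 → ℝ} (hf : ∀ x, 0 ≤ f x) (hfi : Integrable f)
    (hg : Continuous g) (hgb : ∃ C, ∀ x, ‖g x‖ ≤ C) :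
    (∫ x, f x * g x) ^ 2 ≤ (∫ x, f x) * ∫ x, f x * g x ^ 2 := by
  obtain ⟨C, hC⟩ := hgb
  have h1 : Integrable (fun x => f x * g x) :=
    hfi.mul_bdd (c := C) hg.aestronglyMeasurable (Filter.Eventually.of_forall hC)
  have h2 : Integrable (fun x => f x * g x ^ 2) :=
    hfi.mul_bdd (c := C ^ 2) (hg.pow 2).aestronglyMeasurable
      (Filter.Eventually.of_forall fun x => by
        rw [norm_pow]; exact pow_le_pow_left₀ (norm_nonneg _) (hC x) 2)
  have h := discrim_le_zero (a := ∫ x, f x) (b := -2 * ∫ x, f x * g x)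
    (c := ∫ x, f x * g x ^ 2) fun t => by
      have e : (∫ x, f x) * (t * t) + -2 * (∫ x, f x * g x) * t + ∫ x, f x * g x ^ 2
          = ∫ x, f x * (t - g x) ^ 2 := by
        have e1 : ∀ x, f x * (t - g x) ^ 2
            = f x * (t * t) + (f x * g x) * (-2 * t) + f x * g x ^ 2 := fun x => by ring
        have h3 : Integrable (fun x => f x * (t * t) + (f x * g x) * (-2 * t)) :=
          (hfi.mul_const _).add (h1.mul_const _)
        simp only [e1]
        rw [integral_add h3 h2,
          integral_add (hfi.mul_const _) (h1.mul_const _), integral_mul_const, integral_mul_const]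
        ring
      rw [e]
      exact integral_nonneg fun x => mul_nonneg (hf x) (sq_nonneg _)
  unfold discrim at h
  nlinarith

theorem norm_sub_le_biSup {h : R3 → ℂ} (hb : ∃ C, ∀ x, ‖h x‖ ≤ C) {R : ℝ} {x y : R3}
    (hy : ‖y‖ ≤ R) :
    ‖h (x - y) - h x‖ ≤ ⨆ y ∈ Metric.closedBall (0 : R3) R, ‖h (x - y) - h x‖ := by
  obtain ⟨C, hC⟩ := hb
  have hmem : y ∈ Metric.closedBall (0 : R3) R := by simpa using hy
  have hC0 : 0 ≤ C := (norm_nonneg _).trans (hC 0)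
  refine le_trans (le_of_eq ?_) (le_ciSup (f := fun y : R3 =>
    ⨆ (_ : y ∈ Metric.closedBall (0 : R3) R), ‖h (x - y) - h x‖) ⟨C + C, ?_⟩ y)
  · simp only [ciSup_pos hmem]
  · rintro _ ⟨z, rfl⟩
    exact Real.iSup_le (fun _ => (norm_sub_le _ _).trans (add_le_add (hC _) (hC _)))
      (add_nonneg hC0 hC0)

/-- The oscillation over the ball of radius `R` of the frequency-localised part `m(p)ψ` is
controlled by the modulus of continuity of the kernel `m̂`. -/
theorem norm_ift_mul_ft_sub_le {m : R3 → ℂ} (hm : Integrable m)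
    (hb : ∃ C, ∀ x, ‖ft m x‖ ≤ C) {R : ℝ} {fR : R3 → ℝ}
    (hfR : ∀ x : R3, fR x = ⨆ y ∈ Metric.closedBall (0 : R3) R, ‖ft m (x - y) - ft m x‖)
    (hfR_int : Integrable fR) (ψ : SchwartzMap R3 ℂ) {x x' : R3} (hx : ‖x‖ ≤ R) (hx' : ‖x'‖ ≤ R) :
    ‖ift (fun p => m p * ft (fun y => ψ y) p) x - ift (fun p => m p * ft (fun y => ψ y) p) x'‖
      ≤ (2 * π) ^ (-(3:ℝ)/2) * (2 * ∫ y, fR y * ‖ψ y‖) := by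
  rw [ift_mul_ft_eq_convolution hm, ift_mul_ft_eq_convolution hm, ← mul_sub]
  have hcont : Continuous (ft m) := by
    rw [funext (ft_eq_ift_neg m)]
    exact (continuous_ift hm).comp continuous_neg
  obtain ⟨C, hC⟩ := id hb
  have hi : ∀ x : R3, Integrable fun y => ψ y * ft m (y - x) := fun x =>
    ψ.integrable.mul_bdd (c := C) (by fun_prop : Continuous _).aestronglyMeasurable
      (Filter.Eventually.of_forall fun y => hC _)
  obtain ⟨M, hM⟩ : ∃ M, ∀ y, ‖ψ y‖ ≤ M :=
    ⟨_, fun y => ψ.toBoundedContinuousFunction.norm_coe_le_norm y⟩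
  have hfψ : Integrable fun y => fR y * ‖ψ y‖ :=
    hfR_int.mul_bdd (c := M) ψ.continuous.norm.aestronglyMeasurable
      (Filter.Eventually.of_forall fun y => by rw [norm_norm]; exact hM y)
  rw [norm_mul, Complex.norm_real, Real.norm_of_nonneg (by positivity),
    ← integral_sub (hi x) (hi x')]
  refine mul_le_mul_of_nonneg_left ?_ (by positivity)
  rw [← integral_const_mul]
  refine norm_integral_le_of_norm_le (hfψ.const_mul 2) (Filter.Eventually.of_forall fun y => ?_)
  have h1 : ‖ft m (y - x) - ft m y‖ ≤ fR y := (hfR y).symm ▸ norm_sub_le_biSup hb hx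
  have h2 : ‖ft m (y - x') - ft m y‖ ≤ fR y := (hfR y).symm ▸ norm_sub_le_biSup hb hx'
  have h3 : ‖ft m (y - x) - ft m (y - x')‖ ≤ 2 * fR y := by
    have := norm_sub_le (ft m (y - x) - ft m y) (ft m (y - x') - ft m y)
    rw [sub_sub_sub_cancel_right] at this
    linarith
  rw [← mul_sub, norm_mul]
  nlinarith [norm_nonneg (ψ y)]

/-- Averaging a family of inequalities along rays against a normalised radial weight. -/
theorem integral_radial_weight_mul_le {U P G : R3 → ℝ}
    (hU : Integrable U) (hU_nonneg : ∀ x, 0 ≤ U x)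
    (hU_radial : ∀ x y : R3, ‖x‖ = ‖y‖ → U x = U y) (hU_int : (∫ x : R3, U x) = 4 * π)
    (hUP : Integrable (fun x => U x * P x)) (hG : Integrable G)
    (hray : ∀ (ω : Metric.sphere (0 : R3) 1) (s : ℝ), 0 < s → U (s • (ω : R3)) ≠ 0 →
      P (s • (ω : R3)) ≤ ∫ r in Set.Ioi (0:ℝ), r ^ 2 * G (r • (ω : R3))) :
    ∫ x, U x * P x ≤ ∫ x, G x := by
  have hone : ∫ s in Set.Ioi (0:ℝ), s ^ 2 * radialProfile U s = 1 := by
    have h1 := integral_polar hU.aestronglyMeasurable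
    rw [integral_prod _ (integrable_polar hU), hU_int] at h1
    simp only [radialProfile_eq hU_radial] at h1
    rw [integral_const, toSphere_real_univ, smul_eq_mul] at h1
    exact (mul_right_cancel₀ (b := 4 * π) (by positivity) (by linarith))
  have hUi : Integrable (fun s : ℝ => s ^ 2 * radialProfile U s)
      (volume.restrict (Set.Ioi (0:ℝ))) := by
    by_contra hn
    rw [integral_undef hn] at hone
    exact zero_ne_one hone
  have hE := (integrable_polar hG).integral_prod_left
  rw [integral_polar hUP.aestronglyMeasurable, integral_polar hG.aestronglyMeasurable,
    integral_prod _ (integrable_polar hG)]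
  have hmain : ∫ p : Metric.sphere (0 : R3) 1 × ℝ,
        (∫ r in Set.Ioi (0:ℝ), r ^ 2 * G (r • (p.1 : R3))) * (p.2 ^ 2 * radialProfile U p.2)
        ∂((volume : Measure R3).toSphere.prod (volume.restrict (Set.Ioi (0:ℝ))))
      = ∫ ω : Metric.sphere (0 : R3) 1, (∫ r in Set.Ioi (0:ℝ), r ^ 2 * G (r • (ω : R3)))
        ∂(volume : Measure R3).toSphere := by
    rw [integral_prod_mul (μ := (volume : Measure R3).toSphere)
      (ν := volume.restrict (Set.Ioi (0:ℝ)))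
      (fun ω : Metric.sphere (0 : R3) 1 => ∫ r in Set.Ioi (0:ℝ), r ^ 2 * G (r • (ω : R3)))
      (fun s : ℝ => s ^ 2 * radialProfile U s), hone, mul_one]
  rw [← hmain]
  refine integral_mono_ae (integrable_polar hUP) (hE.mul_prod hUi) ?_
  have hpos : ∀ᵐ p : Metric.sphere (0 : R3) 1 × ℝ
      ∂((volume : Measure R3).toSphere.prod (volume.restrict (Set.Ioi (0:ℝ)))), 0 < p.2 :=
    Measure.quasiMeasurePreserving_snd.ae (ae_restrict_mem measurableSet_Ioi)
  filter_upwards [hpos] with p hp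
  have hr := radialProfile_eq hU_radial p.2 p.1
  rw [← hr]
  by_cases h0 : U (p.2 • (p.1 : R3)) = 0
  · simp [h0]
  · have := mul_le_mul_of_nonneg_left (hray p.1 p.2 hp h0)
      (mul_nonneg (sq_nonneg p.2) (hU_nonneg (p.2 • (p.1 : R3))))
    linarith

theorem setIntegral_Ioi_indicator_ball {G : R3 → ℝ} {R : ℝ} (hR : 0 ≤ R)
    (ω : Metric.sphere (0 : R3) 1) :
    ∫ r in Set.Ioi (0:ℝ), r ^ 2 * (Metric.ball (0 : R3) R).indicator G (r • (ω : R3))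
      = ∫ r in (0:ℝ)..R, r ^ 2 * G (r • (ω : R3)) := by
  have hmem : ∀ r : ℝ, 0 < r → (r • (ω : R3) ∈ Metric.ball (0 : R3) R ↔ r < R) := by
    intro r hr
    simp [norm_smul, abs_of_pos hr]
  rw [intervalIntegral.integral_of_le hR, integral_Ioc_eq_integral_Ioo,
    setIntegral_eq_of_subset_of_forall_sdiff_eq_zero measurableSet_Ioi
      (Set.Ioo_subset_Ioi_self : Set.Ioo 0 R ⊆ Set.Ioi 0)]
  · refine setIntegral_congr_fun measurableSet_Ioo fun r hr => ?_
    simp only [Set.indicator_of_mem ((hmem r hr.1).2 hr.2)]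
  · rintro r ⟨hr, hr2⟩
    have : r • (ω : R3) ∉ Metric.ball (0 : R3) R := fun h => hr2 ⟨hr, (hmem r hr).1 h⟩
    rw [Set.indicator_of_notMem this, mul_zero]

theorem norm_sum_coord_mul_sq_le (ω : Metric.sphere (0 : R3) 1) (z : Fin 3 → ℂ) :
    ‖∑ j : Fin 3, ((ω : R3) j : ℂ) * z j‖ ^ 2 ≤ ∑ j : Fin 3, ‖z j‖ ^ 2 := by
  have hω : ∑ j : Fin 3, (ω : R3) j ^ 2 = 1 := by
    have h := EuclideanSpace.real_norm_sq_eq (ω : R3)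
    rw [← h]; simp
  have h1 : ‖∑ j : Fin 3, ((ω : R3) j : ℂ) * z j‖ ≤ ∑ j : Fin 3, |(ω : R3) j| * ‖z j‖ := by
    refine (norm_sum_le _ _).trans (le_of_eq (Finset.sum_congr rfl fun j _ => ?_))
    rw [norm_mul, Complex.norm_real, Real.norm_eq_abs]
  have h2 := Finset.sum_mul_sq_le_sq_mul_sq Finset.univ (fun j => |(ω : R3) j|) (fun j => ‖z j‖)
  simp only [sq_abs, hω, one_mul] at h2
  exact (pow_le_pow_left₀ (norm_nonneg _) h1 2).trans h2

theorem generalized_dyson_lemma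
    (v φ : R3 → ℝ) (R0 a : ℝ) (hR0 : 0 < R0)
    (hv_meas : Measurable v)
    (hv_nonneg : ∀ x, 0 ≤ v x)
    (hv_bdd : ∃ C, ∀ x, v x ≤ C)
    (hv_radial : ∀ x y : R3, ‖x‖ = ‖y‖ → v x = v y)
    (hv_supp : ∀ x : R3, R0 ≤ ‖x‖ → v x = 0)
    (hφ_C1 : ContDiff ℝ 1 φ)
    (hφ_nonneg : ∀ x, 0 ≤ φ x)
    (hφ_le_one : ∀ x, φ x ≤ 1)
    (hφ_eq : ∀ x : R3, R0 ≤ ‖x‖ → φ x = 1 - a / ‖x‖)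
    (hφ_scatt : ∀ g : R3 → ℝ, ContDiff ℝ (⊤ : ℕ∞) g → HasCompactSupport g →
      (∫ x : R3, ⟪gradient φ x, gradient g x⟫) + (1/2) * ∫ x : R3, v x * φ x * g x = 0)
    (R : ℝ) (hR : R0 < R)
    -- the radial cutoff function χ and `h = \widehat{1-χ}`:
    (χ : R3 → ℝ)
    (hχ_meas : Measurable χ)
    (hχ_nonneg : ∀ p, 0 ≤ χ p)
    (hχ_le_one : ∀ p, χ p ≤ 1)
    (hχ_radial : ∀ p p' : R3, ‖p‖ = ‖p'‖ → χ p = χ p')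
    (hχ_int : Integrable (fun p : R3 => 1 - χ p))
    (h : R3 → ℂ)
    (hh : ∀ x, h x = ft (fun p => 1 - (χ p : ℂ)) x)
    (hh_bdd : ∃ C, ∀ x, ‖h x‖ ≤ C)
    (hh_int : Integrable h)
    -- `f_R` and its integrability:
    (fR : R3 → ℝ)
    (hfR : ∀ x : R3, fR x = ⨆ y ∈ Metric.closedBall (0 : R3) R, ‖h (x - y) - h x‖)
    (hfR_int : Integrable fR)
    -- the soft potential U:
    (U : R3 → ℝ)
    (hU_meas : Measurable U)
    (hU_nonneg : ∀ x, 0 ≤ U x)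
    (hU_radial : ∀ x y : R3, ‖x‖ = ‖y‖ → U x = U y)
    (hU_supp : ∀ x : R3, ‖x‖ < R0 ∨ R < ‖x‖ → U x = 0)
    (hU_int : (∫ x : R3, U x) = 4 * π)
    (ε : ℝ) (hε : 0 < ε)
    (ψ : SchwartzMap R3 ℂ) :
    (1 - ε) * a * (∫ x : R3, U x * ‖ψ x‖ ^ 2)
        - (a / ε) * (∫ x : R3, ((2 / π ^ 2) * fR x * ∫ y : R3, fR y) * ‖ψ x‖ ^ 2) ≤
      (∫ x in Metric.ball (0 : R3) R, ∑ j : Fin 3,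
          ‖ift (fun p => (χ p : ℂ) * (Complex.I * (p j : ℂ)) * ft (fun y => ψ y) p) x‖ ^ 2)
        + (1/2) * ∫ x : R3, v x * ‖ψ x‖ ^ 2 := by
  have hq := fun s => intervalIntegrable_radialSource hv_meas hv_nonneg hv_bdd hφ_C1 0 s
  have hflux := fun r (hr : 0 ≤ r) =>
    sq_mul_sphereMeanDeriv_eq hv_meas hv_nonneg hv_bdd hv_radial hφ_C1 hφ_scatt hr
  have hu0 : ∀ r, 0 ≤ sphereMean φ r := fun r =>
    (sphereMean_mem_Icc hφ_C1.continuous (fun x => ⟨hφ_nonneg x, hφ_le_one x⟩) r).1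
  have hu1 : ∀ r, sphereMean φ r ≤ 1 := fun r =>
    (sphereMean_mem_Icc hφ_C1.continuous (fun x => ⟨hφ_nonneg x, hφ_le_one x⟩) r).2
  have hqs : ∀ s, R0 ≤ s → ∫ t in (0:ℝ)..s, radialSource v φ t = a := fun s hs => by
    rw [← hflux s (hR0.le.trans hs), sq_mul_sphereMeanDeriv_of_scattering hR0 hφ_C1 hφ_eq hs]
  set k : ℝ → ℝ := fun t => 1 / 2 * (t ^ 2 * radialProfile v t) with hk
  have hk0 : ∀ t, 0 ≤ k t := fun t =>
    mul_nonneg (by norm_num) (mul_nonneg (sq_nonneg t) (hv_nonneg _))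
  have hsource : radialSource v φ = fun t => k t * sphereMean φ t := by
    ext t; simp only [radialSource, hk]; ring
  have hki : ∀ s, IntervalIntegrable k volume 0 s := fun s => by
    obtain ⟨C, hC⟩ := hv_bdd
    refine ((intervalIntegrable_of_measurable_of_bounded (measurable_radialProfile hv_meas)
      (fun t => hv_nonneg _) (fun t => hC _) 0 s).continuousOn_mul
      (by fun_prop : Continuous fun t : ℝ => 1 / 2 * t ^ 2).continuousOn).congr fun t _ => ?_
    simp only [hk]; ring
  have ha : 0 ≤ a := by
    rw [← hqs R0 le_rfl, hsource]
    exact intervalIntegral.integral_nonneg hR0.le fun t _ => mul_nonneg (hk0 t) (hu0 t)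
  have henergy : ∀ s, R0 ≤ s →
      (∫ r in (0:ℝ)..s, ((r * sphereMeanDeriv φ r) ^ 2 + k r * sphereMean φ r * sphereMean φ r))
        ≤ a := fun s hs => by
    have := integral_scattering_energy_le (hR0.le.trans hs) ha (hasDerivAt_sphereMean hφ_C1)
      (continuous_sphereMeanDeriv hφ_C1) (hq s) hflux (hqs s hs) (hu1 s)
    rwa [hsource] at this
  -- the low-frequency part of `ψ` and the localised gradient
  set F : R3 → ℂ := fun p => (χ p : ℂ) * ft (fun y => ψ y) p with hF
  have hχ_aesm : AEStronglyMeasurable (fun p : R3 => (χ p : ℂ)) :=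
    (Complex.measurable_ofReal.comp hχ_meas).aestronglyMeasurable
  have hχ_norm : ∀ p, ‖(χ p : ℂ)‖ ≤ 1 := fun p => by
    rw [Complex.norm_real, Real.norm_of_nonneg (hχ_nonneg p)]; exact hχ_le_one p
  have hFi : Integrable F := (integrable_ft_schwartz ψ).bdd_mul hχ_aesm
    (Filter.Eventually.of_forall hχ_norm)
  have hFi1 : Integrable (fun p => ‖p‖ * ‖F p‖) := by
    refine (integrable_norm_mul_ft_schwartz ψ).mono'
      (continuous_norm.aestronglyMeasurable.mul hFi.aestronglyMeasurable.norm)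
      (Filter.Eventually.of_forall fun p => ?_)
    rw [norm_mul, norm_norm, norm_norm, norm_mul]
    exact mul_le_mul_of_nonneg_left
      (mul_le_of_le_one_left (norm_nonneg _) (hχ_norm p)) (norm_nonneg _)
  set T : Fin 3 → R3 → ℂ := fun j => ift (fun p => Complex.I * (p j : ℂ) * F p) with hT
  have hT_eq : ∀ j x,
      ift (fun p => (χ p : ℂ) * (Complex.I * (p j : ℂ)) * ft (fun y => ψ y) p) x = T j x := by
    intro j x
    simp only [hT, hF]
    congr 1; ext p; ring
  have hTc : ∀ j, Continuous (T j) := fun j => continuous_ift (integrable_coord_mul hFi hFi1 j)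
  have hm : Integrable (fun p : R3 => 1 - (χ p : ℂ)) := by
    refine hχ_int.ofReal.congr (Filter.Eventually.of_forall fun p => ?_)
    simp
  have hhigh : ∀ x, ψ x - ift F x = ift (fun p => (1 - (χ p : ℂ)) * ft (fun y => ψ y) p) x := by
    intro x
    rw [← ift_ft_schwartz ψ x, ift_sub (integrable_ft_schwartz ψ) hFi]
    congr 1; ext p; simp only [hF]; ring
  obtain rfl : h = ft fun p => 1 - (χ p : ℂ) := funext hh
  set B : ℝ := (2 * π) ^ (-(3:ℝ)/2) * (2 * ∫ y, fR y * ‖ψ y‖) with hBdef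
  have hfR0 : ∀ x, 0 ≤ fR x := fun x => by
    rw [hfR]
    exact Real.iSup_nonneg fun y => Real.iSup_nonneg fun _ => norm_nonneg _
  have hB0 : 0 ≤ B := mul_nonneg (by positivity) (mul_nonneg (by norm_num)
    (integral_nonneg fun y => mul_nonneg (hfR0 y) (norm_nonneg _)))
  have hosc : ∀ x x' : R3, ‖x‖ ≤ R → ‖x'‖ ≤ R →
      ‖(ψ x - ift F x) - (ψ x' - ift F x')‖ ≤ B := fun x x' hx hx' => by
    rw [hhigh, hhigh]
    exact norm_ift_mul_ft_sub_le hm hh_bdd hfR hfR_int ψ hx hx'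
  -- the energy density
  have hψc := ψ.continuous
  obtain ⟨M, hM⟩ : ∃ M, ∀ y, ‖ψ y‖ ≤ M :=
    ⟨_, fun y => ψ.toBoundedContinuousFunction.norm_coe_le_norm y⟩
  set G : R3 → ℝ := fun x => (∑ j, ‖T j x‖ ^ 2) + 1 / 2 * (v x * ‖ψ x‖ ^ 2) with hG
  have hballT : IntegrableOn (fun x => ∑ j, ‖T j x‖ ^ 2) (Metric.ball (0 : R3) R) :=
    ((by fun_prop : Continuous fun x => ∑ j, ‖T j x‖ ^ 2).continuousOn.integrableOn_compact
      (isCompact_closedBall (0 : R3) R)).mono_set Metric.ball_subset_closedBall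
  have hballv : IntegrableOn (fun x => v x * ‖ψ x‖ ^ 2) (Metric.ball (0 : R3) R) := by
    obtain ⟨C, hC⟩ := hv_bdd
    refine Integrable.bdd_mul (c := C) (((by fun_prop : Continuous fun x =>
      ‖ψ x‖ ^ 2).continuousOn.integrableOn_compact (isCompact_closedBall (0 : R3) R)).mono_set
        Metric.ball_subset_closedBall) hv_meas.aestronglyMeasurable
      (Filter.Eventually.of_forall fun x => ?_)
    rw [Real.norm_of_nonneg (hv_nonneg x)]; exact hC x
  have hGball : IntegrableOn G (Metric.ball (0 : R3) R) := hballT.add (hballv.const_mul _)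
  have hRHS : (∫ x in Metric.ball (0 : R3) R, ∑ j : Fin 3,
          ‖ift (fun p => (χ p : ℂ) * (Complex.I * (p j : ℂ)) * ft (fun y => ψ y) p) x‖ ^ 2)
        + (1/2) * ∫ x : R3, v x * ‖ψ x‖ ^ 2
      = ∫ x, (Metric.ball (0 : R3) R).indicator G x := by
    simp only [hT_eq]
    rw [integral_indicator measurableSet_ball, integral_add hballT (hballv.const_mul _),
      integral_const_mul, setIntegral_eq_integral_of_forall_compl_eq_zero
        (f := fun x => v x * ‖ψ x‖ ^ 2)]
    intro x hx
    rw [Metric.mem_ball, dist_zero_right, not_lt] at hx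
    rw [hv_supp x (hR.le.trans hx), zero_mul]
  have hUi : Integrable U := by
    by_contra hn
    rw [integral_undef hn] at hU_int
    have := Real.pi_pos
    linarith
  have hUψ : Integrable (fun x => U x * ‖ψ x‖ ^ 2) :=
    hUi.mul_bdd (c := M ^ 2) (by fun_prop : Continuous fun x => ‖ψ x‖ ^ 2).aestronglyMeasurable
      (Filter.Eventually.of_forall fun x => by
        rw [norm_pow, norm_norm]; exact pow_le_pow_left₀ (norm_nonneg _) (hM x) 2)
  have hUP : Integrable (fun x => U x * ((1 - ε) * a * ‖ψ x‖ ^ 2 - a / ε * B ^ 2)) := by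
    refine ((hUψ.const_mul ((1 - ε) * a)).sub (hUi.const_mul (a / ε * B ^ 2))).congr
      (Filter.Eventually.of_forall fun x => ?_)
    simp only [Pi.sub_apply]; ring
  have key := integral_radial_weight_mul_le hUi hU_nonneg hU_radial hU_int hUP
    (hGball.integrable_indicator measurableSet_ball) ?_
  · rw [hRHS]
    refine le_trans ?_ key
    have e1 : ∫ x, U x * ((1 - ε) * a * ‖ψ x‖ ^ 2 - a / ε * B ^ 2)
        = (1 - ε) * a * (∫ x, U x * ‖ψ x‖ ^ 2) - a / ε * (4 * π * B ^ 2) := by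
      rw [← hU_int]
      have e2 : ∀ x, U x * ((1 - ε) * a * ‖ψ x‖ ^ 2 - a / ε * B ^ 2)
          = (1 - ε) * a * (U x * ‖ψ x‖ ^ 2) - (a / ε * B ^ 2) * U x := fun x => by ring
      simp only [e2]
      rw [integral_sub (hUψ.const_mul _) (hUi.const_mul _), integral_const_mul,
        integral_const_mul]
      ring
    rw [e1]
    have hW : 4 * π * B ^ 2
        ≤ ∫ x : R3, ((2 / π ^ 2) * fR x * ∫ y : R3, fR y) * ‖ψ x‖ ^ 2 := by
      have h1 := sq_integral_mul_le hfR0 hfR_int hψc.norm ⟨M, fun x => by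
        rw [norm_norm]; exact hM x⟩
      have h2 : ∫ x : R3, ((2 / π ^ 2) * fR x * ∫ y : R3, fR y) * ‖ψ x‖ ^ 2
          = (2 / π ^ 2) * ((∫ y : R3, fR y) * ∫ x : R3, fR x * ‖ψ x‖ ^ 2) := by
        rw [← mul_assoc, ← integral_const_mul]
        exact integral_congr_ae (Filter.Eventually.of_forall fun x => by simp only; ring)
      have h3 : 4 * π * B ^ 2 = (2 / π ^ 2) * (∫ y, fR y * ‖ψ y‖) ^ 2 := by
        rw [hBdef, mul_pow, ft_const_sq]
        field_simp
        ring
      rw [h2, h3]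
      exact mul_le_mul_of_nonneg_left h1 (by positivity)
    have := mul_le_mul_of_nonneg_left hW (div_nonneg ha hε.le)
    linarith
  · intro ω s hs hUs
    have hn : ∀ t : ℝ, 0 ≤ t → ‖t • (ω : R3)‖ = t := fun t ht => by
      simp [norm_smul, abs_of_nonneg ht]
    have hsR : R0 ≤ s ∧ s ≤ R := by
      constructor
      · by_contra hlt
        exact hUs (hU_supp _ (Or.inl (by rw [hn s hs.le]; exact not_le.1 hlt)))
      · by_contra hlt
        exact hUs (hU_supp _ (Or.inr (by rw [hn s hs.le]; exact not_le.1 hlt)))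
    rw [setIntegral_Ioi_indicator_ball (hR0.le.trans hR.le)]
    set τ : ℝ → ℂ := fun r => ∑ j : Fin 3, ((ω : R3) j : ℂ) * T j (r • (ω : R3)) with hτ
    have hψω : Continuous fun r : ℝ => ψ (r • (ω : R3)) := by fun_prop
    have hray := radial_energy_lower_bound (ψ := fun r => ψ (r • (ω : R3)))
      (Φ := fun r => ift F (r • (ω : R3))) (τ := τ) hs.le ha hε hB0 hk0 (hki s) hu0
      (continuous_sphereMean hφ_C1) (continuous_sphereMeanDeriv hφ_C1)
      (fun r hr => by rw [hflux r hr, hsource])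
      (by rw [← hsource]; exact hqs s hsR.1) (henergy s hsR.1) hψω (by fun_prop)
      (fun r => hasDerivAt_ift_radial hFi hFi1 (by simp) r)
      (fun t ht hts => hosc _ _ (by rw [hn s hs.le]; exact hsR.2)
        (by rw [hn t ht]; exact hts.trans hsR.2))
    refine hray.trans ?_
    have hint1 : ∀ s, IntervalIntegrable
        (fun r => r ^ 2 * ‖τ r‖ ^ 2 + k r * ‖ψ (r • (ω : R3))‖ ^ 2) volume 0 s := fun s =>
      ((by fun_prop : Continuous fun r => r ^ 2 * ‖τ r‖ ^ 2).intervalIntegrable _ _).add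
        ((hki s).mul_continuousOn
          (by fun_prop : Continuous fun r : ℝ => ‖ψ (r • (ω : R3))‖ ^ 2).continuousOn)
    have hGω : ∀ r : ℝ, r ^ 2 * G (r • (ω : R3))
        = r ^ 2 * (∑ j, ‖T j (r • (ω : R3))‖ ^ 2) + k r * ‖ψ (r • (ω : R3))‖ ^ 2 := fun r => by
      simp only [hG, hk, radialProfile_eq hv_radial]; ring
    simp only [hGω]
    have hint2 : ∀ s, IntervalIntegrable (fun r => r ^ 2 * (∑ j, ‖T j (r • (ω : R3))‖ ^ 2)
        + k r * ‖ψ (r • (ω : R3))‖ ^ 2) volume 0 s := fun s =>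
      ((by fun_prop : Continuous fun r : ℝ =>
        r ^ 2 * (∑ j, ‖T j (r • (ω : R3))‖ ^ 2)).intervalIntegrable _ _).add
        ((hki s).mul_continuousOn
          (by fun_prop : Continuous fun r : ℝ => ‖ψ (r • (ω : R3))‖ ^ 2).continuousOn)
    refine (intervalIntegral.integral_mono_on hs.le (hint1 s) (hint2 s) fun r _ => ?_).trans
      (intervalIntegral.integral_mono_interval le_rfl hs.le hsR.2
        (Filter.Eventually.of_forall fun r => ?_) (hint2 R))
    · have := mul_le_mul_of_nonneg_left
        (norm_sum_coord_mul_sq_le ω fun j => T j (r • (ω : R3))) (sq_nonneg r)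
      linarith
    · exact add_nonneg (mul_nonneg (sq_nonneg r) (Finset.sum_nonneg fun j _ => sq_nonneg _))
        (mul_nonneg (hk0 r) (sq_nonneg _))
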